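/- Let G be a group and let N be a normal subgroup of G of finite index admitting a chain of subgroups {1} = A₀ ≤ A₁ ≤ … ≤ A_n = N, with each Aᵢ normal in G, together with, for each i ∈ {1,…,n}, either (a) an outer commutator word wᵢ of weight tᵢ such that the quotient group Aᵢ/Aᵢ₋₁ satisfies the identity wᵢ = 1, or (b) a radical class 𝓚ᵢ of groups, which in case i ≥ 2 is moreover a formation, such that Aᵢ/Aᵢ₋₁ lies in 𝓚ᵢ (and set tᵢ = 1 in this case). Then G has a characteristic subgroup H of finite index admitting a chain {1} = B₀ ≤ B₁ ≤ … ≤ B_n = H of subgroups normal in G such that, for each i, the quotient Bᵢ/Bᵢ₋₁ satisfies the identity wᵢ = 1 in case (a), respectively lies in 𝓚ᵢ in case (b); moreover log₂[G : H] ≤ f^{t−1}(log₂[G : N]), where t = t₁t₂⋯t_n. -/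

import Mathlib

universe u

/-- A *class of groups*: a predicate on groups in a fixed universe. -/
abbrev GroupClass : Type (u + 1) := ∀ (H : Type u) [Group H], Prop

/-- A class of groups is invariant under group isomorphism. -/
def IsoClosed (C : GroupClass.{u}) : Prop :=
  ∀ (A B : Type u) [Group A] [Group B], (A ≃* B) → C A → C B

/-- A class of groups is *radical* if it is closed under normal subgroups and under
products of two normal subgroups. -/
def IsRadicalClass (C : GroupClass.{u}) : Prop :=
  (∀ (A : Type u) [Group A] (K : Subgroup A), K.Normal → C A → C ↥K) ∧
  (∀ (A : Type u) [Group A] (K₁ K₂ : Subgroup A), K₁.Normal → K₂.Normal →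
    K₁ ⊔ K₂ = ⊤ → C ↥K₁ → C ↥K₂ → C A)

/-- A class of groups is a *formation* if it is closed under quotients and under
subdirect products of two groups. -/
def IsFormation (C : GroupClass.{u}) : Prop :=
  (∀ (A : Type u) [Group A] (K : Subgroup A) [K.Normal], C A → C (A ⧸ K)) ∧
  (∀ (A B : Type u) [Group A] [Group B] (K : Subgroup (A × B)),
    (Function.Surjective fun k : ↥K => (k : A × B).1) →
    (Function.Surjective fun k : ↥K => (k : A × B).2) →
    C A → C B → C ↥K)

/-- Full binary trees encoding outer commutator words. -/
inductive CTree : Type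
  | leaf : CTree
  | node : CTree → CTree → CTree

/-- The weight (number of leaves) of an outer commutator word. -/
def CTree.weight : CTree → ℕ
  | .leaf => 1
  | .node a b => a.weight + b.weight

/-- The verbal subgroup `w_T(N₁,…,N_t)` associated with an outer commutator word `T`. -/
def CTree.sub {G : Type*} [Group G] :
    (T : CTree) → (Fin T.weight → Subgroup G) → Subgroup G
  | .leaf, N => N ⟨0, Nat.one_pos⟩
  | .node a b, N =>
      ⁅a.sub (fun i => N (Fin.castAdd b.weight i)),
        b.sub (fun i => N (Fin.natAdd a.weight i))⁆

/-- `quotStep C K N hK` says that the quotient group `N/K` (for `K`, `N` subgroups of an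
ambient group `G` with `K` normal in `G`) lies in the class `C`. -/
def quotStep (C : GroupClass.{u}) {G : Type u} [Group G]
    (K N : Subgroup G) (hK : K.Normal) : Prop :=
  haveI : (K.subgroupOf N).Normal := hK.subgroupOf N
  C (↥N ⧸ K.subgroupOf N)


theorem quotStep_iff {C : GroupClass.{u}} (hC : IsoClosed C) {G : Type u} [Group G]
    {K N : Subgroup G} (hK : K.Normal) {Q : Type u} [Group Q] (f : N →* Q)
    (hf : Function.Surjective f) (hker : f.ker = K.subgroupOf N) :
    quotStep C K N hK ↔ C Q := by
  unfold quotStep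
  have : (K.subgroupOf N).Normal := hK.subgroupOf N
  have e : (↥N ⧸ K.subgroupOf N) ≃* Q :=
    (QuotientGroup.quotientMulEquivOfEq hker.symm).trans
      (QuotientGroup.quotientKerEquivOfSurjective f hf)
  exact ⟨fun h => hC _ _ e h, fun h => hC _ _ e.symm h⟩

theorem quotStep_iff_range {C : GroupClass.{u}} (hC : IsoClosed C) {G : Type u} [Group G]
    {K N : Subgroup G} (hK : K.Normal) {Q : Type u} [Group Q] (f : N →* Q) (D : Subgroup Q)
    (hD : f.range = D) (hker : f.ker = K.subgroupOf N) :
    quotStep C K N hK ↔ C D := by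
  subst hD
  refine quotStep_iff hC hK f.rangeRestrict f.rangeRestrict_surjective ?_
  rw [MonoidHom.ker_rangeRestrict, hker]

theorem quotStep_restrict {C : GroupClass.{u}} (hC : IsoClosed C) (hR : IsRadicalClass C)
    {G : Type u} [Group G] {K N N' : Subgroup G} (hK : K.Normal) (hN' : N'.Normal)
    (hle : N' ≤ N) (h : quotStep C K N hK) : quotStep C K N' hK := by
  have : (K.subgroupOf N).Normal := hK.subgroupOf N
  have : (N'.subgroupOf N).Normal := hN'.subgroupOf N
  have h1 := hR.1 (↥N ⧸ K.subgroupOf N) ((N'.subgroupOf N).map (QuotientGroup.mk' _))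
    (Subgroup.Normal.map inferInstance _ (QuotientGroup.mk'_surjective _)) h
  let g : N' →* (↥N ⧸ K.subgroupOf N) :=
    (QuotientGroup.mk' (K.subgroupOf N)).comp (Subgroup.inclusion hle)
  refine (quotStep_iff_range hC hK g _ ?_ ?_).2 h1
  · ext y
    constructor
    · rintro ⟨x, rfl⟩
      exact ⟨Subgroup.inclusion hle x, x.2, rfl⟩
    · rintro ⟨x, hx, rfl⟩
      exact ⟨⟨x.1, hx⟩, rfl⟩
  · ext x
    simp only [g, MonoidHom.mem_ker, MonoidHom.comp_apply, QuotientGroup.mk'_apply,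
      QuotientGroup.eq_one_iff, Subgroup.mem_subgroupOf]
    rfl

theorem quotStep_quot {C : GroupClass.{u}} (hC : IsoClosed C) (hF : IsFormation C)
    {G : Type u} [Group G] {K L N : Subgroup G} (hK : K.Normal) (hL : L.Normal)
    (hle : K ≤ L) (h : quotStep C K N hK) : quotStep C L N hL := by
  have : (K.subgroupOf N).Normal := hK.subgroupOf N
  have : (L.subgroupOf N).Normal := hL.subgroupOf N
  have h1 := hF.1 (↥N ⧸ K.subgroupOf N) ((L.subgroupOf N).map (QuotientGroup.mk' _)) h
  exact hC _ _ (QuotientGroup.quotientQuotientEquivQuotient (K.subgroupOf N) (L.subgroupOf N)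
    (fun x hx => hle hx)) h1

theorem quotStep_sup {C : GroupClass.{u}} (hC : IsoClosed C) (hR : IsRadicalClass C)
    {G : Type u} [Group G] {K A B : Subgroup G} (hK : K.Normal)
    (hA : A.Normal) (hB : B.Normal)
    (h : quotStep C K A hK) (h' : quotStep C K B hK) : quotStep C K (A ⊔ B) hK := by
  have : (K.subgroupOf (A ⊔ B)).Normal := hK.subgroupOf _
  have key : ∀ D : Subgroup G, (hD : D ≤ A ⊔ B) → quotStep C K D hK →
      C ((D.subgroupOf (A ⊔ B)).map (QuotientGroup.mk' (K.subgroupOf (A ⊔ B)))) := by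
    intro D hle hD
    let g : D →* (↥(A ⊔ B) ⧸ K.subgroupOf (A ⊔ B)) :=
      (QuotientGroup.mk' (K.subgroupOf (A ⊔ B))).comp (Subgroup.inclusion hle)
    refine (quotStep_iff_range hC hK g _ ?_ ?_).1 hD
    · ext y
      constructor
      · rintro ⟨x, rfl⟩
        exact ⟨Subgroup.inclusion hle x, x.2, rfl⟩
      · rintro ⟨x, hx, rfl⟩
        exact ⟨⟨x.1, hx⟩, rfl⟩
    · ext x
      simp only [g, MonoidHom.mem_ker, MonoidHom.comp_apply, QuotientGroup.mk'_apply,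
        QuotientGroup.eq_one_iff, Subgroup.mem_subgroupOf]
      rfl
  refine hR.2 (↥(A ⊔ B) ⧸ K.subgroupOf (A ⊔ B))
    ((A.subgroupOf (A ⊔ B)).map (QuotientGroup.mk' _))
    ((B.subgroupOf (A ⊔ B)).map (QuotientGroup.mk' _))
    (Subgroup.Normal.map (hA.subgroupOf _) _ (QuotientGroup.mk'_surjective _))
    (Subgroup.Normal.map (hB.subgroupOf _) _ (QuotientGroup.mk'_surjective _)) ?_
    (key A le_sup_left h) (key B le_sup_right h')
  rw [← Subgroup.map_sup, ← Subgroup.subgroupOf_sup le_sup_left le_sup_right,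
    Subgroup.subgroupOf_self]
  exact Subgroup.map_top_of_surjective _ (QuotientGroup.mk'_surjective _)

theorem quotStep_inf {C : GroupClass.{u}} (hC : IsoClosed C) (hF : IsFormation C)
    {G : Type u} [Group G] {K L A : Subgroup G} (hK : K.Normal) (hL : L.Normal)
    (hKL : (K ⊓ L).Normal)
    (h : quotStep C K A hK) (h' : quotStep C L A hL) : quotStep C (K ⊓ L) A hKL := by
  have : (K.subgroupOf A).Normal := hK.subgroupOf _
  have : (L.subgroupOf A).Normal := hL.subgroupOf _
  let g : A →* (A ⧸ K.subgroupOf A) × (A ⧸ L.subgroupOf A) :=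
    (QuotientGroup.mk' (K.subgroupOf A)).prod (QuotientGroup.mk' (L.subgroupOf A))
  have h1 := hF.2 (A ⧸ K.subgroupOf A) (A ⧸ L.subgroupOf A) g.range ?_ ?_ h h'
  · refine (quotStep_iff hC hKL g.rangeRestrict g.rangeRestrict_surjective ?_).2 h1
    rw [MonoidHom.ker_rangeRestrict]
    ext x
    simp [g, MonoidHom.mem_ker, Subgroup.mem_subgroupOf, Prod.ext_iff,
      QuotientGroup.eq_one_iff]
  · intro y
    obtain ⟨x, rfl⟩ := QuotientGroup.mk'_surjective _ y
    exact ⟨⟨g x, x, rfl⟩, rfl⟩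
  · intro y
    obtain ⟨x, rfl⟩ := QuotientGroup.mk'_surjective _ y
    exact ⟨⟨g x, x, rfl⟩, rfl⟩

theorem quotStep_map {C : GroupClass.{u}} (hC : IsoClosed C)
    {G : Type u} [Group G] {K A : Subgroup G} (hK : K.Normal) (φ : G ≃* G)
    (hK' : (K.map φ.toMonoidHom).Normal)
    (h : quotStep C K A hK) :
    quotStep C (K.map φ.toMonoidHom) (A.map φ.toMonoidHom) hK' := by
  have : (K.subgroupOf A).Normal := hK.subgroupOf _
  let e : A ≃* A.map φ.toMonoidHom := φ.subgroupMap A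
  refine (quotStep_iff hC hK' ((QuotientGroup.mk' (K.subgroupOf A)).comp e.symm.toMonoidHom)
    ?_ ?_).2 h
  · exact (QuotientGroup.mk'_surjective _).comp e.symm.surjective
  · ext x
    obtain ⟨y, rfl⟩ := e.surjective x
    have : ((e y : A.map φ.toMonoidHom) : G) = φ y := rfl
    rw [MonoidHom.mem_ker, Subgroup.mem_subgroupOf, this]
    have h1 : ((QuotientGroup.mk' (K.subgroupOf A)).comp e.symm.toMonoidHom) (e y)
        = QuotientGroup.mk' (K.subgroupOf A) y :=
      congrArg (QuotientGroup.mk' (K.subgroupOf A)) (e.symm_apply_apply y)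
    rw [h1, QuotientGroup.mk'_apply, QuotientGroup.eq_one_iff, Subgroup.mem_subgroupOf]
    exact (Subgroup.mem_map_iff_mem φ.injective).symm

theorem quotStep_congr {C : GroupClass.{u}} (hC : IsoClosed C) {G : Type u} [Group G]
    {K K' N : Subgroup G} (hK : K.Normal) (hK' : K'.Normal)
    (hh : K.subgroupOf N = K'.subgroupOf N) (h : quotStep C K N hK) : quotStep C K' N hK' := by
  have : (K.subgroupOf N).Normal := hK.subgroupOf _
  exact (quotStep_iff hC hK' (QuotientGroup.mk' (K.subgroupOf N))
    (QuotientGroup.mk'_surjective _) (by simpa using hh)).2 h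

theorem CTree.sub_normal {G : Type*} [Group G] (T : CTree) (N : Fin T.weight → Subgroup G)
    (h : ∀ i, (N i).Normal) : (T.sub N).Normal := by
  induction T with
  | leaf => exact h _
  | node a b iha ihb =>
    have := iha _ (fun i => h (Fin.castAdd b.weight i))
    have := ihb _ (fun i => h (Fin.natAdd a.weight i))
    exact Subgroup.commutator_normal _ _

theorem CTree.sub_mono {G : Type*} [Group G] (T : CTree) (N N' : Fin T.weight → Subgroup G)
    (h : ∀ i, N i ≤ N' i) : T.sub N ≤ T.sub N' := by
  induction T with
  | leaf => exact h _
  | node a b iha ihb =>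
    exact Subgroup.commutator_mono (iha _ _ (fun i => h (Fin.castAdd b.weight i)))
      (ihb _ _ (fun i => h (Fin.natAdd a.weight i)))

theorem CTree.sub_map {G G' : Type*} [Group G] [Group G'] (T : CTree)
    (N : Fin T.weight → Subgroup G) (f : G →* G') :
    (T.sub N).map f = T.sub (fun i => (N i).map f) := by
  induction T with
  | leaf => rfl
  | node a b iha ihb =>
    show Subgroup.map f ⁅_, _⁆ = ⁅_, _⁆
    rw [Subgroup.map_commutator, iha, ihb]

theorem comm_sup_le {G : Type*} [Group G] (X Y Z : Subgroup G) (hX : X.Normal) (hY : Y.Normal)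
    (hZ : Z.Normal) : ⁅X ⊔ Y, Z⁆ ≤ ⁅X, Z⁆ ⊔ ⁅Y, Z⁆ := by
  rw [Subgroup.commutator_le]
  intro g hg z hz
  obtain ⟨x, hx, y, hy, rfl⟩ := Subgroup.mem_sup_of_normal_left.1 hg
  rw [commutatorElement_mul_left_eq_conj_mul]
  refine mul_mem ?_ ?_
  · refine Subgroup.mem_sup_right ?_
    have := Subgroup.commutator_normal Y Z
    exact this.conj_mem _ (Subgroup.commutator_mem_commutator hy hz) x
  · exact Subgroup.mem_sup_left (Subgroup.commutator_mem_commutator hx hz)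

theorem CTree.sub_mult {G : Type*} [Group G] (T : CTree) (N N' N'' : Fin T.weight → Subgroup G)
    (h : ∀ i, (N i).Normal) (h' : ∀ i, (N' i).Normal)
    (k : Fin T.weight) (hk : N'' k ≤ N k ⊔ N' k)
    (hj : ∀ j, j ≠ k → N'' j ≤ N j ∧ N'' j ≤ N' j) : T.sub N'' ≤ T.sub N ⊔ T.sub N' := by
  induction T with
  | leaf =>
    have : k = ⟨0, Nat.one_pos⟩ := Subsingleton.elim (α := Fin 1) _ _
    subst this
    exact hk
  | node a b iha ihb =>
    have na := a.sub_normal _ (fun i => h (Fin.castAdd b.weight i))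
    have nb := b.sub_normal _ (fun i => h (Fin.natAdd a.weight i))
    have na' := a.sub_normal _ (fun i => h' (Fin.castAdd b.weight i))
    have nb' := b.sub_normal _ (fun i => h' (Fin.natAdd a.weight i))
    revert hk hj
    refine Fin.addCases (m := a.weight) (n := b.weight) ?_ ?_ k
    · intro k hk hj
      have h1 := iha _ _ _ (fun i => h (Fin.castAdd b.weight i))
        (fun i => h' (Fin.castAdd b.weight i)) k hk
        (fun j hjk => hj _ (fun hc => hjk (Fin.castAdd_injective _ _ hc)))
      have hne : ∀ j, Fin.natAdd a.weight j ≠ Fin.castAdd b.weight k := by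
        intro j hc
        have := congrArg Fin.val hc
        simp at this
        omega
      have h2 := b.sub_mono _ _ (fun i => (hj _ (hne i)).1)
      have h3 := b.sub_mono _ _ (fun i => (hj _ (hne i)).2)
      refine (Subgroup.commutator_mono h1 (le_inf h2 h3)).trans ?_
      refine (comm_sup_le _ _ _ na na' inferInstance).trans ?_
      exact sup_le_sup (Subgroup.commutator_mono le_rfl inf_le_left)
        (Subgroup.commutator_mono le_rfl inf_le_right)
    · intro k hk hj
      have h1 := ihb _ _ _ (fun i => h (Fin.natAdd a.weight i))
        (fun i => h' (Fin.natAdd a.weight i)) k hk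
        (fun j hjk => hj _ (fun hc => hjk (Fin.natAdd_injective _ _ hc)))
      have hne : ∀ j, Fin.castAdd b.weight j ≠ Fin.natAdd a.weight k := by
        intro j hc
        have := congrArg Fin.val hc
        simp at this
        omega
      have h2 := a.sub_mono _ _ (fun i => (hj _ (hne i)).1)
      have h3 := a.sub_mono _ _ (fun i => (hj _ (hne i)).2)
      refine (Subgroup.commutator_mono (le_inf h2 h3) h1).trans ?_
      rw [Subgroup.commutator_comm]
      refine (comm_sup_le _ _ _ nb nb' inferInstance).trans ?_
      rw [Subgroup.commutator_comm, Subgroup.commutator_comm (b.sub _) (_ ⊓ _)]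
      exact sup_le_sup (Subgroup.commutator_mono inf_le_left le_rfl)
        (Subgroup.commutator_mono inf_le_right le_rfl)

theorem CTree.weight_pos (T : CTree) : 0 < T.weight := by
  induction T with
  | leaf => exact Nat.one_pos
  | node a b iha ihb => exact Nat.add_pos_left iha _

theorem CTree.quotStep_iff_le (T : CTree) {C : GroupClass.{u}}
    (hC : ∀ (Q : Type u) [Group Q], C Q ↔ T.sub (fun _ => (⊤ : Subgroup Q)) = ⊥)
    {G : Type u} [Group G] {K N : Subgroup G} (hK : K.Normal) :
    quotStep C K N hK ↔ T.sub (fun _ => N) ≤ K := by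
  have : (K.subgroupOf N).Normal := hK.subgroupOf _
  unfold quotStep
  rw [hC]
  have h1 := T.sub_map (fun _ => (⊤ : Subgroup N)) (QuotientGroup.mk' (K.subgroupOf N))
  simp only [Subgroup.map_top_of_surjective _ (QuotientGroup.mk'_surjective _)] at h1
  have h2 := T.sub_map (fun _ => (⊤ : Subgroup N)) N.subtype
  simp only [← MonoidHom.range_eq_map, Subgroup.range_subtype] at h2
  rw [← h1, ← h2, Subgroup.map_eq_bot_iff, QuotientGroup.ker_mk', Subgroup.map_le_iff_le_comap]
  rfl

theorem sup_normal_aux {G : Type*} [Group G] {α : Type*} (s : Finset α) (F : α → Subgroup G)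
    (hF : ∀ a, (F a).Normal) : (s.sup F).Normal := by
  classical
  induction s using Finset.induction_on with
  | empty => simpa using (inferInstance : (⊥ : Subgroup G).Normal)
  | insert a s ha ih =>
    rw [Finset.sup_insert]
    have := hF a
    exact Subgroup.sup_normal _ _

theorem inf_aux {G : Type*} [Group G] {α : Type*} (s : Finset α) (F : α → Subgroup G)
    (hF : ∀ a, (F a).Normal) (m : ℕ) (hm : 0 < m) (hi : ∀ a, (F a).index = m) :
    (s.inf F).Normal ∧ (s.inf F).FiniteIndex ∧ (s.inf F).index ≤ m ^ s.card := by
  classical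
  induction s using Finset.induction_on with
  | empty =>
    simp only [Finset.inf_empty]
    exact ⟨inferInstance, inferInstance, by simp⟩
  | insert a s ha ih =>
    rw [Finset.inf_insert, Finset.card_insert_of_notMem ha]
    obtain ⟨h1, h2, h3⟩ := ih
    have := hF a
    have : (F a).FiniteIndex := ⟨by rw [hi a]; omega⟩
    refine ⟨Subgroup.normal_inf_normal _ _, inferInstance, ?_⟩
    refine Subgroup.index_inf_le.trans ?_
    rw [hi a, pow_succ, mul_comm]
    exact Nat.mul_le_mul_right _ h3

theorem aut_step {G : Type*} [Group G] (N : Subgroup G) (hN : N.Normal)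
    (hfin : N.FiniteIndex) : ∃ s : Finset (G ≃* G), s.Nonempty ∧
      (s.sup (fun φ => N.map φ.toMonoidHom)).Characteristic ∧
      N ≤ s.sup (fun φ => N.map φ.toMonoidHom) ∧
      s.inf (fun φ => N.map φ.toMonoidHom) ≤ N ∧
      (s.inf (fun φ => N.map φ.toMonoidHom)).Normal ∧
      (s.inf (fun φ => N.map φ.toMonoidHom)).FiniteIndex ∧
      Real.logb 2 ((s.inf (fun φ => N.map φ.toMonoidHom)).index : ℝ) ≤
        Real.logb 2 (N.index : ℝ) * (Real.logb 2 (N.index : ℝ) + 1) := by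
  classical
  set F : (G ≃* G) → Subgroup G := fun φ => N.map φ.toMonoidHom with hF
  have hFn : ∀ φ, (F φ).Normal := fun φ => hN.map _ φ.surjective
  have hrefl : F (MulEquiv.refl G) = N := by
    simp only [hF]
    ext x
    simp [Subgroup.mem_map]
  have hm : 0 < N.index := Nat.pos_of_ne_zero hfin.index_ne_zero
  have hex : ∃ d : ℕ, ∃ s : Finset (G ≃* G), MulEquiv.refl G ∈ s ∧ (s.sup F).index = d ∧
      2 ^ (s.card - 1) * (s.sup F).index ≤ N.index := by
    refine ⟨_, {MulEquiv.refl G}, by simp, rfl, ?_⟩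
    simp [hrefl]
  obtain ⟨s, hs1, hs2, hs3⟩ := Nat.find_spec hex
  have hNs : N ≤ s.sup F := by
    calc N = F (MulEquiv.refl G) := hrefl.symm
      _ ≤ _ := Finset.le_sup (f := F) hs1
  have hall : ∀ φ, F φ ≤ s.sup F := by
    intro φ
    by_contra hcon
    have hlt : s.sup F < (insert φ s).sup F := by
      rw [Finset.sup_insert]
      exact right_lt_sup.2 hcon
    have hfi1 : (s.sup F).FiniteIndex := Subgroup.finiteIndex_of_le hNs
    have hfi2 : ((insert φ s).sup F).FiniteIndex := Subgroup.finiteIndex_of_le hlt.le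
    have h1 := Subgroup.relIndex_mul_index hlt.le
    have h2 : (s.sup F).relIndex ((insert φ s).sup F) ≠ 1 := by
      rw [Ne, Subgroup.relIndex_eq_one]
      exact hlt.not_ge
    have h3 := hfi1.index_ne_zero
    have h4 := hfi2.index_ne_zero
    have h5 : 2 ≤ (s.sup F).relIndex ((insert φ s).sup F) := by
      rcases Nat.lt_or_ge ((s.sup F).relIndex ((insert φ s).sup F)) 2 with h | h
      · exfalso
        interval_cases hh : (s.sup F).relIndex ((insert φ s).sup F)
        · simp at h1; omega
        · exact h2 rfl
      · exact h
    have h6 : 2 * ((insert φ s).sup F).index ≤ (s.sup F).index := by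
      rw [← h1]; exact Nat.mul_le_mul_right _ h5
    have hφ : φ ∉ s := fun h => hcon (Finset.le_sup (f := F) h)
    refine Nat.find_min hex (m := ((insert φ s).sup F).index) (by rw [← hs2]; omega)
      ⟨insert φ s, by simp [hs1], rfl, ?_⟩
    have hc : 0 < s.card := Finset.card_pos.2 ⟨_, hs1⟩
    rw [Finset.card_insert_of_notMem hφ]
    obtain ⟨c, hc'⟩ : ∃ c, s.card = c + 1 := ⟨s.card - 1, by omega⟩
    rw [hc'] at hs3 ⊢
    simp only [Nat.add_sub_cancel] at hs3 ⊢
    calc 2 ^ (c + 1) * ((insert φ s).sup F).index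
        = 2 ^ c * (2 * ((insert φ s).sup F).index) := by ring
      _ ≤ 2 ^ c * (s.sup F).index := Nat.mul_le_mul_left _ h6
      _ ≤ _ := hs3
  obtain ⟨i1, i2, i3⟩ := inf_aux s F hFn N.index hm (fun φ => Subgroup.index_map_equiv N φ)
  refine ⟨s, ⟨_, hs1⟩, ?_, hNs, ?_, i1, i2, ?_⟩
  · rw [Subgroup.characteristic_iff_map_le]
    intro φ
    rw [Subgroup.map_le_iff_le_comap]
    refine Finset.sup_le ?_
    intro ψ _
    rw [← Subgroup.map_le_iff_le_comap]
    refine le_trans (le_of_eq ?_) (hall (ψ.trans φ))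
    simp only [hF]
    rw [Subgroup.map_map]
    rfl
  · calc s.inf F ≤ F (MulEquiv.refl G) := Finset.inf_le (f := F) hs1
      _ = N := hrefl
  · have hfi1 : (s.sup F).FiniteIndex := Subgroup.finiteIndex_of_le hNs
    have hc : 0 < s.card := Finset.card_pos.2 ⟨_, hs1⟩
    have h1 : 2 ^ (s.card - 1) ≤ N.index :=
      (Nat.le_mul_of_pos_right _ (Nat.pos_of_ne_zero hfi1.index_ne_zero)).trans hs3
    have h2 : ((s.card - 1 : ℕ) : ℝ) ≤ Real.logb 2 (N.index : ℝ) := by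
      rw [Real.le_logb_iff_rpow_le (by norm_num) (by exact_mod_cast hm), Real.rpow_natCast]
      exact_mod_cast h1
    have h3 : (s.card : ℝ) ≤ Real.logb 2 (N.index : ℝ) + 1 := by
      rw [Nat.cast_sub (by omega)] at h2
      push_cast at h2
      linarith
    have h4 : 0 ≤ Real.logb 2 (N.index : ℝ) :=
      Real.logb_nonneg (by norm_num) (by exact_mod_cast hm)
    have h5 : Real.logb 2 ((s.inf F).index : ℝ) ≤ Real.logb 2 ((N.index : ℝ) ^ s.card) := by
      refine Real.logb_le_logb_of_le (by norm_num) ?_ (by exact_mod_cast i3)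
      exact_mod_cast Nat.pos_of_ne_zero i2.index_ne_zero
    rw [Real.logb_pow] at h5
    nlinarith

/-- Admissible predicates on tuples of normal subgroups. -/
structure Adm {G : Type*} [Group G] {ι : Type} (P : (ι → Subgroup G) → Prop) : Prop where
  mult : ∀ (N N' N'' : ι → Subgroup G) (k : ι), (∀ j, (N j).Normal) → (∀ j, (N' j).Normal) →
    (∀ j, (N'' j).Normal) → P N → P N' → N'' k ≤ N k ⊔ N' k →
    (∀ j, j ≠ k → N'' j ≤ N j ∧ N'' j ≤ N' j) → P N''
  aut : ∀ (N : ι → Subgroup G) (φ : G ≃* G), (∀ j, (N j).Normal) → P N →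
    P (fun j => (N j).map φ.toMonoidHom)

theorem Adm.mono {G : Type*} [Group G] {ι : Type} [Nonempty ι] {P : (ι → Subgroup G) → Prop}
    (hP : Adm P) (N N' : ι → Subgroup G) (h : ∀ j, (N j).Normal) (h' : ∀ j, (N' j).Normal)
    (hle : ∀ j, N' j ≤ N j) (hN : P N) : P N' :=
  hP.mult N N N' (Classical.arbitrary ι) h h h' hN hN (by simpa using hle _)
    (fun j _ => ⟨hle j, hle j⟩)

theorem Adm.finset_sup {G : Type*} [Group G] {ι : Type} [DecidableEq ι]
    {P : (ι → Subgroup G) → Prop} (hP : Adm P) {α : Type*} (s : Finset α) (hs : s.Nonempty)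
    (F : α → Subgroup G) (hF : ∀ a, (F a).Normal) (N : ι → Subgroup G) (h : ∀ j, (N j).Normal)
    (k : ι) (hh : ∀ a ∈ s, P (Function.update N k (F a))) :
    P (Function.update N k (s.sup F)) := by
  classical
  have hn : ∀ X : Subgroup G, X.Normal → ∀ j, (Function.update N k X j).Normal := by
    intro X hX j
    by_cases hj : j = k
    · subst hj; simpa using hX
    · simpa [hj] using h j
  induction hs using Finset.Nonempty.cons_induction with
  | singleton a => simpa using hh a (by simp)
  | cons a s ha hs ih =>
    have h1 := hh a (by simp)
    have h2 := ih (fun b hb => hh b (by simp [hb]))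
    refine hP.mult _ _ _ k (hn _ (hF a)) (hn _ (sup_normal_aux s F hF))
      (hn _ (sup_normal_aux _ F hF)) h1 h2 ?_ ?_
    · simp
    · intro j hj
      simp [hj]

theorem main_step {G : Type*} [Group G] {ι : Type} [Nonempty ι]
    {P : (ι → Subgroup G) → Prop} (hP : Adm P) (k : ℕ) (N C : Subgroup G) (hN : N.Normal)
    (hfin : N.FiniteIndex) (hC : C.Characteristic) (hNC : N ≤ C)
    (hgood : ∀ J : Set ι, J.ncard = k → J.Finite →
      ∀ U : ι → Subgroup G, (∀ j, (U j).Normal) → (∀ j ∈ J, U j ≤ C) → (∀ j ∉ J, U j ≤ N) → P U) :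
    ∃ N' C' : Subgroup G, N'.Normal ∧ N'.FiniteIndex ∧ C'.Characteristic ∧ N' ≤ C' ∧ N ≤ C' ∧
      Real.logb 2 (N'.index : ℝ) ≤
        Real.logb 2 (N.index : ℝ) * (Real.logb 2 (N.index : ℝ) + 1) ∧
      (∀ J : Set ι, J.ncard = k + 1 → J.Finite →
        ∀ U : ι → Subgroup G, (∀ j, (U j).Normal) → (∀ j ∈ J, U j ≤ C') → (∀ j ∉ J, U j ≤ N') →
        P U) := by
  classical
  obtain ⟨s, hs, h1, h2, h3, h4, h5, h6⟩ := aut_step N hN hfin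
  set F : (G ≃* G) → Subgroup G := fun φ => N.map φ.toMonoidHom with hF
  have hFn : ∀ φ, (F φ).Normal := fun φ => hN.map _ φ.surjective
  refine ⟨s.inf F, s.sup F, h4, h5, h1, h3.trans h2, h2, h6, ?_⟩
  have hC'C : s.sup F ≤ C := by
    refine Finset.sup_le fun φ _ => ?_
    refine (Subgroup.map_mono hNC).trans ?_
    exact Subgroup.characteristic_iff_map_le.1 hC φ
  intro J hJ hJf U hUn hU1 hU2
  obtain ⟨j0, hj0⟩ : J.Nonempty := by
    rw [← Set.ncard_pos hJf]; omega
  have hCn : C.Normal := inferInstance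
  let V : ι → Subgroup G := fun j => if j ∈ J then C else s.inf F
  have hV : ∀ j, (V j).Normal := by
    intro j
    by_cases hj : j ∈ J <;> simp [V, hj, hCn, h4]
  have hn : ∀ X : Subgroup G, X.Normal → ∀ j, (Function.update V j0 X j).Normal := by
    intro X hX j
    by_cases hj : j = j0
    · subst hj; simpa using hX
    · simpa [hj] using hV j
  have key : P (Function.update V j0 (s.sup F)) := by
    refine hP.finset_sup s hs F hFn V hV j0 ?_
    intro φ hφ
    let W : ι → Subgroup G := fun j => if j ∈ J \ {j0} then C else N
    have hWn : ∀ j, (W j).Normal := by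
      intro j
      dsimp only [W]
      split_ifs <;> assumption
    have hW : P W := by
      refine hgood (J \ {j0}) ?_ (hJf.subset Set.diff_subset) W hWn ?_ ?_
      · rw [Set.ncard_diff_singleton_of_mem hj0, hJ]; rfl
      · intro j hj; simp only [W, if_pos hj]; exact le_rfl
      · intro j hj; simp only [W, if_neg hj]; exact le_rfl
    refine hP.mono _ _ (fun j => (hWn j).map _ φ.surjective) (hn _ (hFn φ)) ?_
      (hP.aut W φ hWn hW)
    intro j
    by_cases hj : j = j0
    · subst hj
      simp [W, hF]
    · by_cases hjJ : j ∈ J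
      · have hjJ' : j ∈ J \ {j0} := ⟨hjJ, hj⟩
        simp only [Function.update_of_ne hj, V, W, if_pos hjJ, if_pos hjJ']
        exact Subgroup.characteristic_iff_le_map.1 hC φ
      · have hjJ' : j ∉ J \ {j0} := fun h => hjJ h.1
        simp only [Function.update_of_ne hj, V, W, if_neg hjJ, if_neg hjJ']
        exact Finset.inf_le (f := F) hφ
  refine hP.mono _ _ (hn _ (sup_normal_aux s F hFn)) hUn ?_ key
  intro j
  by_cases hj : j = j0
  · subst hj
    simpa using hU1 _ hj0
  · rw [Function.update_of_ne hj]
    by_cases hjJ : j ∈ J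
    · simp only [V, if_pos hjJ]; exact (hU1 j hjJ).trans hC'C
    · simp only [V, if_neg hjJ]; exact hU2 j hjJ

theorem main_iter {G : Type*} [Group G] {ι : Type} [Nonempty ι]
    {P : (ι → Subgroup G) → Prop} (hP : Adm P) (N : Subgroup G) (hN : N.Normal)
    (hfin : N.FiniteIndex) (hPN : P (fun _ => N)) (k : ℕ) :
    ∃ N' C' : Subgroup G, N'.Normal ∧ N'.FiniteIndex ∧ C'.Characteristic ∧ N' ≤ C' ∧
      Real.logb 2 (N'.index : ℝ) ≤
        (fun x : ℝ => x * (x + 1))^[k] (Real.logb 2 (N.index : ℝ)) ∧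
      (∀ J : Set ι, J.ncard = k → J.Finite →
        ∀ U : ι → Subgroup G, (∀ j, (U j).Normal) → (∀ j ∈ J, U j ≤ C') → (∀ j ∉ J, U j ≤ N') →
        P U) := by
  induction k with
  | zero =>
    refine ⟨N, ⊤, hN, hfin, inferInstance, le_top, by simp, ?_⟩
    intro J hJ hJf U hUn _ hU
    have hJ0 : J = ∅ := (Set.ncard_eq_zero hJf).1 hJ
    subst hJ0
    exact hP.mono _ _ (fun _ => hN) hUn (fun j => hU j (by simp)) hPN
  | succ k ih =>
    obtain ⟨N', C', h1, h2, h3, h4, h5, h6⟩ := ih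
    obtain ⟨N2, C2, a1, a2, a3, a4, a5, a6, a7⟩ := main_step hP k N' C' h1 h2 h3 h4 h6
    refine ⟨N2, C2, a1, a2, a3, a4, ?_, a7⟩
    rw [Function.iterate_succ_apply']
    refine a6.trans ?_
    have h0 : 0 ≤ Real.logb 2 (N'.index : ℝ) :=
      Real.logb_nonneg (by norm_num) (by exact_mod_cast Nat.pos_of_ne_zero h2.index_ne_zero)
    show _ ≤ _ * (_ + 1)
    exact mul_le_mul h5 (by linarith) (by linarith) (h0.trans h5)

theorem main_arg {G : Type*} [Group G] {ι : Type} [Fintype ι] [Nonempty ι]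
    {P : (ι → Subgroup G) → Prop} (hP : Adm P) (N : Subgroup G) (hN : N.Normal)
    (hfin : N.FiniteIndex) (hPN : P (fun _ => N)) :
    ∃ H : Subgroup G, H.Characteristic ∧ H.FiniteIndex ∧
      Real.logb 2 (H.index : ℝ) ≤
        (fun x : ℝ => x * (x + 1))^[Fintype.card ι - 1] (Real.logb 2 (N.index : ℝ)) ∧
      P (fun _ => H) := by
  obtain ⟨N', C', h1, h2, h3, h4, h5, h6⟩ := main_iter hP N hN hfin hPN (Fintype.card ι - 1)
  obtain ⟨N2, C2, a1, a2, a3, a4, a5, a6, a7⟩ := main_step hP _ N' C' h1 h2 h3 h4 h6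
  have hfi : C2.FiniteIndex := Subgroup.finiteIndex_of_le a5
  refine ⟨C2, a3, hfi, ?_, ?_⟩
  · refine le_trans ?_ h5
    refine Real.logb_le_logb_of_le (by norm_num) ?_ ?_
    · exact_mod_cast Nat.pos_of_ne_zero hfi.index_ne_zero
    · exact_mod_cast Nat.le_of_dvd (Nat.pos_of_ne_zero h2.index_ne_zero)
        (Subgroup.index_dvd_of_le a5)
  · have hpos : 0 < Fintype.card ι := Fintype.card_pos
    refine a7 Set.univ ?_ Set.finite_univ _ (fun _ => inferInstance) (fun _ _ => le_rfl)
      (fun j hj => absurd (Set.mem_univ j) hj)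
    rw [Set.ncard_univ, Nat.card_eq_fintype_card]
    omega

theorem quotStep_sup' {C : GroupClass.{u}} (hC : IsoClosed C) (hR : IsRadicalClass C)
    {G : Type u} [Group G] {K K' A B : Subgroup G} (hF : IsFormation C ∨ K = K')
    (hK : K.Normal) (hK' : K'.Normal) (hKK : (K ⊔ K').Normal)
    (hA : A.Normal) (hB : B.Normal)
    (h : quotStep C K A hK) (h' : quotStep C K' B hK') : quotStep C (K ⊔ K') (A ⊔ B) hKK := by
  rcases hF with hF | rfl
  · exact quotStep_sup hC hR hKK hA hB (quotStep_quot hC hF hK hKK le_sup_left h)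
      (quotStep_quot hC hF hK' hKK le_sup_right h')
  · exact quotStep_congr hC hK hKK (by rw [sup_idem]) (quotStep_sup hC hR hK hA hB h h')

theorem quotStep_inf' {C : GroupClass.{u}} (hC : IsoClosed C)
    {G : Type u} [Group G] {K L A : Subgroup G} (hF : IsFormation C ∨ K = L)
    (hK : K.Normal) (hL : L.Normal) (hKL : (K ⊓ L).Normal)
    (h : quotStep C K A hK) (h' : quotStep C L A hL) : quotStep C (K ⊓ L) A hKL := by
  rcases hF with hF | rfl
  · exact quotStep_inf hC hF hK hL hKL h h'
  · exact quotStep_congr hC hK hKL (by rw [inf_idem]) h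

theorem quotStep_finset_inf {C : GroupClass.{u}} (hC : IsoClosed C)
    {G : Type u} [Group G] {A : Subgroup G} {ι : Type} (s : Finset ι) (hs : s.Nonempty)
    (M : ι → Subgroup G) (hF : IsFormation C ∨ ∀ j, M j = ⊥) (hM : ∀ j, (M j).Normal)
    (h : ∀ j, quotStep C (M j) A (hM j)) :
    ∃ (L : Subgroup G) (hL : L.Normal), (∀ j ∈ s, L ≤ M j) ∧ quotStep C L A hL := by
  rcases hF with hF | hF
  · induction hs using Finset.Nonempty.cons_induction with
    | singleton a => exact ⟨M a, hM a, by simp, h a⟩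
    | cons a s ha hs ih =>
      obtain ⟨L, hL, h1, h2⟩ := ih
      have := hM a
      refine ⟨M a ⊓ L, Subgroup.normal_inf_normal _ _, ?_, quotStep_inf hC hF _ _ _ (h a) h2⟩
      intro j hj
      rcases Finset.mem_cons.1 hj with rfl | hj
      · exact inf_le_left
      · exact inf_le_right.trans (h1 j hj)
  · obtain ⟨a, ha⟩ := hs
    refine ⟨M a, hM a, fun j _ => by rw [hF a]; exact bot_le, h a⟩

/-- `H` has a series of normal subgroups of `G` with the prescribed quotients. -/
def HasChain {G : Type u} [Group G] {n : ℕ} (S : Fin n → GroupClass.{u}) (H : Subgroup G) :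
    Prop :=
  ∃ (B : Fin (n + 1) → Subgroup G) (hBnorm : ∀ i, (B i).Normal),
    B 0 = ⊥ ∧ B (Fin.last n) = H ∧
    (∀ i : Fin n, B i.castSucc ≤ B i.succ) ∧
    (∀ i : Fin n, quotStep (S i) (B i.castSucc) (B i.succ) (hBnorm i.castSucc))

theorem HasChain.exists_of_succ {G : Type u} [Group G] {n : ℕ} {S : Fin (n + 1) → GroupClass.{u}}
    {H : Subgroup G} (h : HasChain S H) :
    ∃ (M : Subgroup G) (hM : M.Normal), M ≤ H ∧ quotStep (S (Fin.last n)) M H hM ∧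
      HasChain (fun i : Fin n => S i.castSucc) M := by
  obtain ⟨B, hB, h0, h1, h2, h3⟩ := h
  subst h1
  exact ⟨B (Fin.last n).castSucc, hB _, h2 (Fin.last n), h3 (Fin.last n),
    fun i => B i.castSucc, fun i => hB _, h0, rfl, fun i => h2 i.castSucc,
    fun i => h3 i.castSucc⟩

theorem quotStep_cast {C : GroupClass.{u}} {G : Type u} [Group G] {K K' N N' : Subgroup G}
    (e : K = K') (e' : N = N') (hK : K.Normal) (hK' : K'.Normal) (h : quotStep C K N hK) :
    quotStep C K' N' hK' := by
  subst e e'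
  exact h

theorem HasChain.succ_of {G : Type u} [Group G] {n : ℕ} {S : Fin (n + 1) → GroupClass.{u}}
    {H M : Subgroup G} (hH : H.Normal) (hM : M.Normal) (hle : M ≤ H)
    (hq : quotStep (S (Fin.last n)) M H hM)
    (h : HasChain (fun i : Fin n => S i.castSucc) M) : HasChain S H := by
  obtain ⟨B, hB, h0, h1, h2, h3⟩ := h
  let B' : Fin (n + 1 + 1) → Subgroup G := Fin.snoc (α := fun _ => Subgroup G) B H
  have e1 : ∀ i : Fin (n + 1), B' i.castSucc = B i := fun i => by simp [B']
  have e2 : B' (Fin.last (n + 1)) = H := by simp [B']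
  refine ⟨B', ?_, ?_, e2, ?_, ?_⟩
  · intro i
    refine Fin.lastCases ?_ (fun i => ?_) i
    · rw [e2]; exact hH
    · rw [e1]; exact hB i
  · rw [← h0]; exact e1 0
  · intro i
    refine Fin.lastCases ?_ (fun i => ?_) i
    · rw [e1, Fin.succ_last, e2, h1]; exact hle
    · rw [e1, Fin.succ_castSucc, e1]; exact h2 i
  · intro i
    revert i
    refine Fin.lastCases ?_ (fun i => ?_)
    · refine quotStep_cast ?_ ?_ hM _ hq
      · rw [e1, h1]
      · rw [Fin.succ_last, e2]
    · refine quotStep_cast ?_ ?_ (hB i.castSucc) _ (h3 i)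
      · rw [e1]
      · rw [Fin.succ_castSucc, e1]

theorem exists_adm {G : Type u} [Group G] (n : ℕ) (ty : Fin n → ℕ) (S : Fin n → GroupClass.{u})
    (hcase : ∀ i : Fin n,
      (∃ T : CTree, T.weight = ty i ∧
        ∀ (Q : Type u) [Group Q], S i Q ↔ T.sub (fun _ => (⊤ : Subgroup Q)) = ⊥) ∨
      (ty i = 1 ∧ IsoClosed (S i) ∧ IsRadicalClass (S i) ∧
        (1 ≤ (i : ℕ) → IsFormation (S i)))) :
    ∃ (ι : Type) (_ : Fintype ι) (_ : Nonempty ι) (P : (ι → Subgroup G) → Prop),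
      Fintype.card ι = ∏ i, ty i ∧ Adm P ∧
      (n = 0 → ∀ N, P N → ∀ j, N j = ⊥) ∧
      (∀ N : Subgroup G, N.Normal → HasChain S N → P (fun _ => N)) ∧
      (∀ N : Subgroup G, N.Normal → P (fun _ => N) → HasChain S N) := by
  induction n with
  | zero =>
    refine ⟨Unit, inferInstance, inferInstance, fun N => N () = ⊥, by simp, ⟨?_, ?_⟩, ?_, ?_, ?_⟩
    · rintro N N' N'' ⟨⟩ _ _ _ h h' hk _
      rw [h, h'] at hk
      simpa using hk
    · intro N φ _ h
      simp [h]
    · intro _ N h j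
      exact h
    · rintro N _ ⟨B, hB, h0, h1, -⟩
      rw [← h1]; exact h0
    · intro N hN h
      exact ⟨fun _ => N, fun _ => hN, h, rfl, fun i => i.elim0, fun i => i.elim0⟩
  | succ n ih =>
    obtain ⟨ι, _, _, P, hcard, hP, hbot, hstart, hend⟩ :=
      ih (fun i => ty i.castSucc) (fun i => S i.castSucc) (fun i => hcase i.castSucc)
    rcases hcase (Fin.last n) with ⟨T, hT, hS⟩ | ⟨hty, hC, hR, hF⟩
    · refine ⟨ι × Fin T.weight, inferInstance, ?_,
        fun N => P (fun j => T.sub (fun l => N (j, l))), ?_, ⟨?_, ?_⟩, ?_, ?_, ?_⟩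
      · have : Nonempty (Fin T.weight) := ⟨⟨0, T.weight_pos⟩⟩
        infer_instance
      · rw [Fin.prod_univ_castSucc, ← hcard, ← hT]; simp
      · rintro N N' N'' ⟨k, l⟩ hN hN' hN'' h h' hk hj
        refine hP.mult _ _ _ k (fun j => T.sub_normal _ fun l => hN _)
          (fun j => T.sub_normal _ fun l => hN' _) (fun j => T.sub_normal _ fun l => hN'' _)
          h h' ?_ ?_
        · refine T.sub_mult _ _ _ (fun l => hN _) (fun l => hN' _) l hk ?_
          intro l' hl'
          exact hj _ (fun hc => hl' (Prod.ext_iff.1 hc).2)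
        · intro j hjk
          exact ⟨T.sub_mono _ _ fun l' => (hj _ (fun hc => hjk (Prod.ext_iff.1 hc).1)).1,
            T.sub_mono _ _ fun l' => (hj _ (fun hc => hjk (Prod.ext_iff.1 hc).1)).2⟩
      · intro N φ hN h
        have := hP.aut _ φ (fun j => T.sub_normal _ fun l => hN _) h
        simpa only [CTree.sub_map] using this
      · intro h; omega
      · intro N hN hch
        obtain ⟨M, hM, hle, hq, hch'⟩ := hch.exists_of_succ
        rw [T.quotStep_iff_le hS] at hq
        exact hP.mono _ _ (fun _ => hM) (fun _ => T.sub_normal _ fun _ => hN) (fun _ => hq)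
          (hstart M hM hch')
      · intro N hN h
        have hM : (T.sub (fun _ => N)).Normal := T.sub_normal _ fun _ => hN
        have hle : T.sub (fun _ => N) ≤ N := by
          have aux : ∀ T : CTree, T.sub (fun _ => N) ≤ N := by
            intro T
            induction T with
            | leaf => exact le_rfl
            | node a b iha ihb => exact (Subgroup.commutator_mono iha ihb).trans N.commutator_le_self
          exact aux T
        exact HasChain.succ_of hN hM hle ((T.quotStep_iff_le hS hM).2 le_rfl) (hend _ hM h)
    · have hF' : IsFormation (S (Fin.last n)) ∨ ∀ N, P N → ∀ j, N j = ⊥ := by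
        rcases Nat.eq_zero_or_pos n with h | h
        · exact Or.inr (hbot h)
        · exact Or.inl (hF h)
      refine ⟨ι, inferInstance, inferInstance,
        fun N => ∃ (M : ι → Subgroup G) (hM : ∀ j, (M j).Normal), (∀ j, M j ≤ N j) ∧
          (∀ j, quotStep (S (Fin.last n)) (M j) (N j) (hM j)) ∧ P M, ?_, ⟨?_, ?_⟩, ?_, ?_, ?_⟩
      · rw [Fin.prod_univ_castSucc, ← hcard, hty]; simp
      · classical
        rintro N N' N'' k hN hN' hN'' ⟨M, hM, hle, hq, hPM⟩ ⟨M', hM', hle', hq', hPM'⟩ hk hj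
        have hFM : ∀ j, IsFormation (S (Fin.last n)) ∨ M j = M' j := by
          intro j
          rcases hF' with h | h
          · exact Or.inl h
          · exact Or.inr ((h M hPM j).trans (h M' hPM' j).symm)
        have hsup : ∀ j, (M j ⊔ M' j).Normal := by
          intro j
          have := hM j
          have := hM' j
          exact Subgroup.sup_normal _ _
        have hinf : ∀ j, (M j ⊓ M' j).Normal := by
          intro j
          have := hM j
          have := hM' j
          exact Subgroup.normal_inf_normal _ _
        let L : ι → Subgroup G := fun j => if j = k then M j ⊔ M' j else M j ⊓ M' j
        have hL : ∀ j, (L j).Normal := by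
          intro j
          dsimp only [L]
          split_ifs
          · exact hsup j
          · exact hinf j
        have hL' : ∀ j, (N'' j ⊓ L j).Normal := by
          intro j
          have := hN'' j
          have := hL j
          exact Subgroup.normal_inf_normal _ _
        refine ⟨fun j => N'' j ⊓ L j, hL', fun j => inf_le_left, ?_, ?_⟩
        · intro j
          refine quotStep_congr hC (hL j) (hL' j) (Subgroup.inf_subgroupOf_left _ _).symm ?_
          by_cases hjk : j = k
          · subst hjk
            have e : L j = M j ⊔ M' j := by simp [L]
            refine quotStep_cast e.symm rfl (hsup j) _ ?_
            have hNN : (N j ⊔ N' j).Normal := by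
              have := hN j
              have := hN' j
              exact Subgroup.sup_normal _ _
            exact quotStep_restrict hC hR (hsup j) (hN'' j) hk
              (quotStep_sup' hC hR (hFM j) (hM j) (hM' j) (hsup j) (hN j) (hN' j) (hq j) (hq' j))
          · have e : L j = M j ⊓ M' j := by simp [L, hjk]
            refine quotStep_cast e.symm rfl (hinf j) _ ?_
            exact quotStep_inf' hC (hFM j) (hM j) (hM' j) (hinf j)
              (quotStep_restrict hC hR (hM j) (hN'' j) (hj j hjk).1 (hq j))
              (quotStep_restrict hC hR (hM' j) (hN'' j) (hj j hjk).2 (hq' j))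
        · refine hP.mult M M' _ k hM hM' hL' hPM hPM' ?_ ?_
          · simp [L]
          · intro j hjk
            simp only [L, if_neg hjk]
            exact ⟨inf_le_right.trans inf_le_left, inf_le_right.trans inf_le_right⟩
      · rintro N φ hN ⟨M, hM, hle, hq, hPM⟩
        exact ⟨fun j => (M j).map φ.toMonoidHom, fun j => (hM j).map _ φ.surjective,
          fun j => Subgroup.map_mono (hle j), fun j => quotStep_map hC (hM j) φ _ (hq j),
          hP.aut M φ hM hPM⟩
      · intro h; omega
      · intro N hN hch
        obtain ⟨M, hM, hle, hq, hch'⟩ := hch.exists_of_succ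
        exact ⟨fun _ => M, fun _ => hM, fun _ => hle, fun _ => hq, hstart M hM hch'⟩
      · rintro N hN ⟨M, hM, hle, hq, hPM⟩
        obtain ⟨L, hL, hLM, hLq⟩ := quotStep_finset_inf hC Finset.univ Finset.univ_nonempty M
          (hF'.imp id (fun h => h M hPM)) hM hq
        have hLM' : ∀ j, L ≤ M j := fun j => hLM j (Finset.mem_univ j)
        exact HasChain.succ_of hN hL
          ((hLM' (Classical.arbitrary ι)).trans (hle _)) hLq
          (hend L hL (hP.mono M _ hM (fun _ => hL) hLM' hPM))

/-- **Series theorem.** If a finite-index subgroup `N` of `G` has a `G`-normal series whose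
`i`-th quotient either satisfies an outer commutator identity of weight `tᵢ` or lies in a
radical class (which, except possibly for the first step, is also a formation), then `G` has
a characteristic finite-index subgroup `H` with a `G`-normal series of the same length whose
quotients satisfy the same step conditions, and
`log₂[G:H] ≤ f^{t-1}(log₂[G:N])` where `t = t₁⋯tₙ` and `f(x) = x(x+1)`. -/
theorem stmt_8 {G : Type u} [Group G] (N : Subgroup G) (hNfin : N.FiniteIndex)
    {n : ℕ} (A : Fin (n + 1) → Subgroup G)
    (hA0 : A 0 = ⊥) (hAn : A (Fin.last n) = N)
    (hAmono : ∀ i : Fin n, A i.castSucc ≤ A i.succ)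
    (hAnorm : ∀ i, (A i).Normal)
    (ty : Fin n → ℕ) (S : Fin n → GroupClass.{u})
    (hcase : ∀ i : Fin n,
      (∃ T : CTree, T.weight = ty i ∧
        ∀ (Q : Type u) [Group Q], S i Q ↔ T.sub (fun _ => (⊤ : Subgroup Q)) = ⊥) ∨
      (ty i = 1 ∧ IsoClosed (S i) ∧ IsRadicalClass (S i) ∧
        (1 ≤ (i : ℕ) → IsFormation (S i))))
    (hstep : ∀ i : Fin n,
      quotStep (S i) (A i.castSucc) (A i.succ) (hAnorm i.castSucc)) :
    ∃ H : Subgroup G, H.Characteristic ∧ H.FiniteIndex ∧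
      Real.logb 2 (H.index : ℝ) ≤
        (fun x : ℝ => x * (x + 1))^[(∏ i, ty i) - 1] (Real.logb 2 (N.index : ℝ)) ∧
      ∃ (B : Fin (n + 1) → Subgroup G) (hBnorm : ∀ i, (B i).Normal),
        B 0 = ⊥ ∧ B (Fin.last n) = H ∧
        (∀ i : Fin n, B i.castSucc ≤ B i.succ) ∧
        (∀ i : Fin n,
          quotStep (S i) (B i.castSucc) (B i.succ) (hBnorm i.castSucc)) := by
  obtain ⟨ι, _, _, P, hcard, hP, -, hstart, hend⟩ := exists_adm (G := G) n ty S hcase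
  have hN : N.Normal := hAn ▸ hAnorm (Fin.last n)
  obtain ⟨H, h1, h2, h3, h4⟩ := main_arg hP N hN hNfin
    (hstart N hN ⟨A, hAnorm, hA0, hAn, hAmono, hstep⟩)
  rw [hcard] at h3
  exact ⟨H, h1, h2, h3, hend H inferInstance h4⟩
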